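/- arXiv:2012.00539 — 2 statements merged into one kernel-verified Lean document; each statement's English description precedes it below -/
import Mathlib

section
/- Let ℋ⁻(τ) := (1/(4√π)) Σ_{n≥1} n Γ(−1/2, 4πn²v) e^{−2πin²τ} + 1/(8π√v) be the nonholomorphic part of Zagier's function, for τ = u+iv ∈ ℍ. Then ξ_{3/2}(ℋ⁻)(τ) = −(1/(16π)) Θ(τ), where Θ(τ) := Σ_{n∈ℤ} e^{2πin²τ} is the classical theta function. (Consequently the generating function of Hurwitz class numbers is a mock modular form of weight 3/2 whose shadow is a multiple of Θ.) -/
open Complex MeasureTheory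

noncomputable section

/-- The incomplete Gamma value Γ(−1/2, x) = ∫ₓ^∞ e^{−t} t^{−3/2} dt. -/
def incGammaNegHalf (x : ℝ) : ℝ := ∫ t in Set.Ioi x, Real.exp (-t) * t ^ (-(3:ℝ)/2)

/-- The antiholomorphic Wirtinger derivative ∂f/∂τ̄ = (1/2)(∂f/∂u + i ∂f/∂v). -/
def dbar (f : ℂ → ℂ) (τ : ℂ) : ℂ :=
  (1/2) * (fderiv ℝ f τ 1 + Complex.I * fderiv ℝ f τ Complex.I)

/-- The shadow operator ξ_{3/2}(f)(τ) = 2i v^{3/2} conj(∂f/∂τ̄(τ)). -/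
def xiThreeHalves (f : ℂ → ℂ) (τ : ℂ) : ℂ :=
  2 * Complex.I * ((τ.im ^ ((3:ℝ)/2) : ℝ) : ℂ) * (starRingEnd ℂ) (dbar f τ)

/-- The nonholomorphic part ℋ⁻ of Zagier's function. -/
def zagierHminus (z : ℂ) : ℂ :=
  (1 / (4 * Real.sqrt Real.pi)) *
      ∑' n : ℕ, ((n : ℂ) + 1) * (incGammaNegHalf (4 * Real.pi * ((n : ℝ) + 1)^2 * z.im) : ℂ) *
        Complex.exp (-2 * Real.pi * Complex.I * ((n : ℂ) + 1)^2 * z)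
  + 1 / (8 * Real.pi * Real.sqrt z.im)

/-- The classical theta function Θ(τ) = Σ_{n ∈ ℤ} e^{2πin²τ}. -/
def Theta (τ : ℂ) : ℂ := ∑' n : ℤ, Complex.exp (2 * Real.pi * Complex.I * (n : ℂ)^2 * τ)

/-- The integrand of `Γ(-1/2, x)` is dominated by `x ^ (-3/2) * exp (-t)` on `(x, ∞)`. -/
lemma exp_neg_mul_rpow_le {x t : ℝ} (hx : 0 < x) (ht : x < t) :
    Real.exp (-t) * t ^ (-(3:ℝ)/2) ≤ x ^ (-(3:ℝ)/2) * Real.exp (-t) := by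
  rw [mul_comm]
  exact mul_le_mul_of_nonneg_right
    (Real.rpow_le_rpow_of_nonpos hx ht.le (by norm_num)) (Real.exp_nonneg _)

lemma continuousAt_exp_neg_mul_rpow {t : ℝ} (ht : 0 < t) :
    ContinuousAt (fun t : ℝ => Real.exp (-t) * t ^ (-(3:ℝ)/2)) t :=
  (Real.continuous_exp.comp continuous_neg).continuousAt.mul
    (Real.continuousAt_rpow_const _ _ (Or.inl ht.ne'))

lemma integrableOn_exp_neg_mul_rpow {x : ℝ} (hx : 0 < x) :
    IntegrableOn (fun t : ℝ => Real.exp (-t) * t ^ (-(3:ℝ)/2)) (Set.Ioi x) := by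
  refine Integrable.mono' ((integrableOn_exp_neg_Ioi x).const_mul (x ^ (-(3:ℝ)/2))) ?_ ?_
  · refine ContinuousOn.aestronglyMeasurable (fun t ht => ?_) measurableSet_Ioi
    exact (continuousAt_exp_neg_mul_rpow (hx.trans ht)).continuousWithinAt
  · refine (ae_restrict_iff' measurableSet_Ioi).2 (ae_of_all _ fun t ht => ?_)
    have ht0 : 0 < t := hx.trans ht
    rw [Real.norm_of_nonneg (by positivity)]
    exact exp_neg_mul_rpow_le hx ht

lemma incGammaNegHalf_nonneg {x : ℝ} (hx : 0 < x) : 0 ≤ incGammaNegHalf x := by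
  refine setIntegral_nonneg measurableSet_Ioi fun t ht => ?_
  have ht0 : 0 < t := hx.trans ht
  positivity

lemma incGammaNegHalf_le {x : ℝ} (hx : 0 < x) :
    incGammaNegHalf x ≤ x ^ (-(3:ℝ)/2) * Real.exp (-x) := by
  rw [← integral_exp_neg_Ioi x, ← integral_const_mul]
  exact setIntegral_mono_on (integrableOn_exp_neg_mul_rpow hx)
    ((integrableOn_exp_neg_Ioi x).const_mul _) measurableSet_Ioi
    fun t ht => exp_neg_mul_rpow_le hx ht

lemma hasDerivAt_incGammaNegHalf {x : ℝ} (hx : 0 < x) :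
    HasDerivAt incGammaNegHalf (-(Real.exp (-x) * x ^ (-(3:ℝ)/2))) x := by
  set g : ℝ → ℝ := fun t => Real.exp (-t) * t ^ (-(3:ℝ)/2) with hg
  have hcont : ContinuousOn g (Set.Ioi 0) := fun t ht =>
    (continuousAt_exp_neg_mul_rpow ht).continuousWithinAt
  have hsub : HasDerivAt (fun y => incGammaNegHalf x - ∫ t in x..y, g t) (-(g x)) x := by
    refine (intervalIntegral.integral_hasDerivAt_right (by simp)
      (hcont.stronglyMeasurableAtFilter isOpen_Ioi x hx)
      (continuousAt_exp_neg_mul_rpow hx)).const_sub _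
  refine hsub.congr_of_eventuallyEq ?_
  filter_upwards [lt_mem_nhds hx] with y hy
  have := intervalIntegral.integral_Ioi_sub_Ioi' (integrableOn_exp_neg_mul_rpow hx)
    (integrableOn_exp_neg_mul_rpow hy)
  simp only [incGammaNegHalf, hg]
  linarith

/-- The summand of the nonholomorphic part of Zagier's function, for a real index `N`. -/
def nonholTerm (N : ℝ) (z : ℂ) : ℂ :=
  (N : ℂ) * (incGammaNegHalf (4 * Real.pi * N ^ 2 * z.im) : ℂ) *
    Complex.exp (-2 * Real.pi * Complex.I * (N : ℂ) ^ 2 * z)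

/-- The real derivative of `nonholTerm`. -/
def nonholTermDeriv (N : ℝ) (z : ℂ) : ℂ →L[ℝ] ℂ :=
  (((-(4 * Real.pi * N ^ 3) * (Real.exp (-(4 * Real.pi * N ^ 2 * z.im)) *
      (4 * Real.pi * N ^ 2 * z.im) ^ (-(3:ℝ)/2)) : ℝ) : ℂ) *
    Complex.exp (-2 * Real.pi * Complex.I * (N : ℂ) ^ 2 * z)) • (ofRealCLM.comp imCLM) +
  ((N : ℂ) * (incGammaNegHalf (4 * Real.pi * N ^ 2 * z.im) : ℂ) *
    (Complex.exp (-2 * Real.pi * Complex.I * (N : ℂ) ^ 2 * z) *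
      (-2 * Real.pi * Complex.I * (N : ℂ) ^ 2))) • ContinuousLinearMap.id ℝ ℂ

lemma hasFDerivAt_nonholTerm {N : ℝ} (hN : 0 < N) {z : ℂ} (hz : 0 < z.im) :
    HasFDerivAt (nonholTerm N) (nonholTermDeriv N z) z := by
  have hpos : 0 < 4 * Real.pi * N ^ 2 * z.im := by positivity
  have hG := ofRealCLM.hasFDerivAt.comp z ((hasDerivAt_incGammaNegHalf hpos).comp_hasFDerivAt z
    (imCLM.hasFDerivAt.const_mul (4 * Real.pi * N ^ 2)))
  have hE : HasDerivAt (fun w : ℂ => Complex.exp (-2 * Real.pi * Complex.I * (N : ℂ) ^ 2 * w))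
      (Complex.exp (-2 * Real.pi * Complex.I * (N : ℂ) ^ 2 * z) *
        (-2 * Real.pi * Complex.I * (N : ℂ) ^ 2)) z := by
    simpa only [mul_one, id] using ((hasDerivAt_id z).const_mul (-2 * Real.pi * Complex.I * (N : ℂ) ^ 2)).cexp
  refine ((hG.const_mul (N : ℂ)).mul (hE.hasFDerivAt.restrictScalars ℝ)).congr_fderiv ?_
  ext
  simp [nonholTermDeriv]
  ring

lemma norm_exp_nonhol (N : ℝ) (z : ℂ) :
    ‖Complex.exp (-2 * Real.pi * Complex.I * (N : ℂ) ^ 2 * z)‖ =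
      Real.exp (2 * Real.pi * N ^ 2 * z.im) := by
  rw [Complex.norm_exp]
  congr 1
  have : (-2 * Real.pi * Complex.I * (N : ℂ) ^ 2 * z) =
      ((-2 * Real.pi * N ^ 2 : ℝ) : ℂ) * (Complex.I * z) := by push_cast; ring
  rw [this, re_ofReal_mul]
  simp

/-- On `c < im z`, the factors `exp (-4πN²v) (4πN²v) ^ (-3/2) |exp (-2πiN²z)|` decay. -/
lemma exp_factor_le {N c v : ℝ} (hN : 1 ≤ N) (hc : 0 < c) (hv : c < v) :
    (4 * Real.pi * N ^ 2 * v) ^ (-(3:ℝ)/2) * Real.exp (-(4 * Real.pi * N ^ 2 * v)) *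
        Real.exp (2 * Real.pi * N ^ 2 * v) ≤
      (4 * Real.pi * c) ^ (-(3:ℝ)/2) * Real.exp (-(2 * Real.pi * c) * N) := by
  rw [mul_assoc, ← Real.exp_add]
  have hN2 : N ≤ N ^ 2 := by nlinarith
  have hNv : N * c ≤ N ^ 2 * v := mul_le_mul hN2 hv.le hc.le (by positivity)
  refine mul_le_mul (Real.rpow_le_rpow_of_nonpos (by positivity) ?_ (by norm_num))
    (Real.exp_le_exp.2 ?_) (Real.exp_nonneg _) (by positivity)
  · have hcv : c ≤ N ^ 2 * v := by nlinarith
    nlinarith [mul_le_mul_of_nonneg_left hcv Real.pi_pos.le]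
  · nlinarith [mul_le_mul_of_nonneg_left hNv Real.pi_pos.le]

lemma norm_nonholTerm_le {N c : ℝ} (hN : 1 ≤ N) (hc : 0 < c) {z : ℂ} (hz : c < z.im) :
    ‖nonholTerm N z‖ ≤
      N * ((4 * Real.pi * c) ^ (-(3:ℝ)/2) * Real.exp (-(2 * Real.pi * c) * N)) := by
  have hz0 : 0 < z.im := hc.trans hz
  have hpos : 0 < 4 * Real.pi * N ^ 2 * z.im := by positivity
  rw [nonholTerm, norm_mul, norm_mul, norm_exp_nonhol, Complex.norm_of_nonneg (by positivity),
    Complex.norm_of_nonneg (incGammaNegHalf_nonneg hpos), mul_assoc]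
  refine mul_le_mul_of_nonneg_left (le_trans ?_ (exp_factor_le hN hc hz)) (by positivity)
  exact mul_le_mul_of_nonneg_right (incGammaNegHalf_le hpos) (Real.exp_nonneg _)

lemma norm_nonholTermDeriv_le {N c : ℝ} (hN : 1 ≤ N) (hc : 0 < c) {z : ℂ} (hz : c < z.im) :
    ‖nonholTermDeriv N z‖ ≤ 6 * Real.pi * N ^ 3 *
      ((4 * Real.pi * c) ^ (-(3:ℝ)/2) * Real.exp (-(2 * Real.pi * c) * N)) := by
  have hz0 : 0 < z.im := hc.trans hz
  have hpos : 0 < 4 * Real.pi * N ^ 2 * z.im := by positivity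
  have hfac := exp_factor_le hN hc hz
  set B := (4 * Real.pi * c) ^ (-(3:ℝ)/2) * Real.exp (-(2 * Real.pi * c) * N)
  have hIm : ‖ofRealCLM.comp imCLM‖ ≤ 1 :=
    ContinuousLinearMap.opNorm_le_bound _ zero_le_one fun w => by
      simpa using Complex.abs_im_le_norm w
  have hnonhol := norm_nonholTerm_le hN hc hz
  have hfst : ‖((-(4 * Real.pi * N ^ 3) * (Real.exp (-(4 * Real.pi * N ^ 2 * z.im)) *
      (4 * Real.pi * N ^ 2 * z.im) ^ (-(3:ℝ)/2)) : ℝ) : ℂ) *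
      Complex.exp (-2 * Real.pi * Complex.I * (N : ℂ) ^ 2 * z)‖ ≤ 4 * Real.pi * N ^ 3 * B := by
    rw [norm_mul, norm_exp_nonhol, Complex.norm_real, norm_mul, norm_neg,
      Real.norm_of_nonneg (by positivity), Real.norm_of_nonneg (by positivity), mul_assoc]
    refine mul_le_mul_of_nonneg_left ?_ (by positivity)
    rwa [mul_comm (Real.exp _)]
  have hsnd : ‖(N : ℂ) * (incGammaNegHalf (4 * Real.pi * N ^ 2 * z.im) : ℂ) *
      (Complex.exp (-2 * Real.pi * Complex.I * (N : ℂ) ^ 2 * z) *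
        (-2 * Real.pi * Complex.I * (N : ℂ) ^ 2))‖ ≤ 2 * Real.pi * N ^ 3 * B := by
    rw [← mul_assoc, norm_mul]
    have hk : ‖(-2 * Real.pi * Complex.I * (N : ℂ) ^ 2)‖ = 2 * Real.pi * N ^ 2 := by
      simp [abs_of_pos Real.pi_pos]
    rw [hk]
    calc _ ≤ (N * B) * (2 * Real.pi * N ^ 2) :=
          mul_le_mul_of_nonneg_right hnonhol (by positivity)
      _ = _ := by ring
  calc ‖nonholTermDeriv N z‖ ≤ 4 * Real.pi * N ^ 3 * B * 1 + 2 * Real.pi * N ^ 3 * B * 1 := by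
        refine (norm_add_le _ _).trans (add_le_add ?_ ?_)
        · rw [norm_smul]
          exact mul_le_mul hfst hIm (norm_nonneg _) ((norm_nonneg _).trans hfst)
        · rw [norm_smul]
          exact mul_le_mul hsnd ContinuousLinearMap.norm_id_le (norm_nonneg _)
            ((norm_nonneg _).trans hsnd)
    _ = _ := by ring

lemma summable_add_one_pow_mul_exp (k : ℕ) {r : ℝ} (hr : 0 < r) :
    Summable fun n : ℕ => ((n : ℝ) + 1) ^ k * Real.exp (-r * ((n : ℝ) + 1)) := by
  simpa using (summable_nat_add_iff 1).2 (Real.summable_pow_mul_exp_neg_nat_mul k hr)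

/-- Wirtinger derivative of a real-linear map, as in `dbar`. -/
def dbarLinear : (ℂ →L[ℝ] ℂ) →L[ℝ] ℂ :=
  (1 / 2 : ℂ) • (ContinuousLinearMap.apply ℝ ℂ (1 : ℂ) +
    Complex.I • ContinuousLinearMap.apply ℝ ℂ Complex.I)

lemma dbarLinear_apply (L : ℂ →L[ℝ] ℂ) :
    dbarLinear L = (1 / 2) * (L 1 + Complex.I * L Complex.I) := by
  simp [dbarLinear, mul_add]

lemma summable_norm_bound {c : ℝ} (hc : 0 < c) :
    Summable fun n : ℕ => 6 * Real.pi * ((n : ℝ) + 1) ^ 3 *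
      ((4 * Real.pi * c) ^ (-(3:ℝ)/2) * Real.exp (-(2 * Real.pi * c) * ((n : ℝ) + 1))) := by
  refine ((summable_add_one_pow_mul_exp 3 (r := 2 * Real.pi * c) (by positivity)).mul_left
    (6 * Real.pi * (4 * Real.pi * c) ^ (-(3:ℝ)/2))).congr fun n => ?_
  ring

lemma summable_nonholTermDeriv {τ : ℂ} (hτ : 0 < τ.im) :
    Summable fun n : ℕ => nonholTermDeriv ((n : ℝ) + 1) τ :=
  (summable_norm_bound (half_pos hτ)).of_norm_bounded fun n =>
    norm_nonholTermDeriv_le (by linarith [n.cast_nonneg (α := ℝ)]) (half_pos hτ) (half_lt_self hτ)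

lemma summable_nonholTerm {τ : ℂ} (hτ : 0 < τ.im) :
    Summable fun n : ℕ => nonholTerm ((n : ℝ) + 1) τ := by
  refine Summable.of_norm_bounded
    (g := fun n : ℕ => ((n : ℝ) + 1) * ((4 * Real.pi * (τ.im / 2)) ^ (-(3:ℝ)/2) *
      Real.exp (-(2 * Real.pi * (τ.im / 2)) * ((n : ℝ) + 1)))) ?_ fun n =>
    norm_nonholTerm_le (by linarith [n.cast_nonneg (α := ℝ)]) (half_pos hτ) (half_lt_self hτ)
  refine ((summable_add_one_pow_mul_exp 1 (r := 2 * Real.pi * (τ.im / 2))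
    (by positivity)).mul_left ((4 * Real.pi * (τ.im / 2)) ^ (-(3:ℝ)/2))).congr fun n => ?_
  ring

lemma hasFDerivAt_tsum_nonholTerm {τ : ℂ} (hτ : 0 < τ.im) :
    HasFDerivAt (fun z => ∑' n : ℕ, nonholTerm ((n : ℝ) + 1) z)
      (∑' n : ℕ, nonholTermDeriv ((n : ℝ) + 1) τ) τ := by
  have hc := half_pos hτ
  have hmem : τ ∈ {z : ℂ | τ.im / 2 < z.im} := half_lt_self hτ
  exact hasFDerivAt_tsum_of_isPreconnected (summable_norm_bound hc)
    (isOpen_lt continuous_const Complex.continuous_im)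
    (convex_halfSpace_im_gt _).isPreconnected
    (fun n z hz => hasFDerivAt_nonholTerm (by positivity) (hc.trans hz))
    (fun n z hz => norm_nonholTermDeriv_le (by linarith [n.cast_nonneg (α := ℝ)]) hc hz)
    hmem (summable_nonholTerm hτ) hmem

lemma rpow_four_pi_sq_mul {N v : ℝ} (hN : 0 < N) (hv : 0 < v) :
    (4 * Real.pi * N ^ 2 * v) ^ (-(3:ℝ)/2) * (4 * Real.pi * N ^ 3) * v ^ ((3:ℝ)/2) =
      1 / (2 * Real.sqrt Real.pi) := by
  have hs : Real.sqrt (4 * Real.pi * N ^ 2) = 2 * N * Real.sqrt Real.pi := by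
    rw [show 4 * Real.pi * N ^ 2 = (2 * N) ^ 2 * Real.pi by ring,
      Real.sqrt_mul (by positivity), Real.sqrt_sq (by positivity)]
  have hA : (4 * Real.pi * N ^ 2) ^ ((3:ℝ)/2) =
      (4 * Real.pi * N ^ 2) * (2 * N * Real.sqrt Real.pi) := by
    rw [← hs, Real.sqrt_eq_rpow, show (3:ℝ)/2 = 1 + 1/2 by norm_num,
      Real.rpow_add (by positivity), Real.rpow_one]
  rw [neg_div, Real.rpow_neg (by positivity), Real.mul_rpow (by positivity) hv.le, hA]
  have : 0 < v ^ ((3:ℝ)/2) := by positivity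
  have := Real.sqrt_pos.2 Real.pi_pos
  field_simp

/-- The Wirtinger derivative of each summand is an antiholomorphic theta term. -/
lemma rpow_mul_conj_dbarLinear_nonholTermDeriv {N : ℝ} (hN : 0 < N) {z : ℂ} (hz : 0 < z.im) :
    ((z.im ^ ((3:ℝ)/2) : ℝ) : ℂ) * (starRingEnd ℂ) (dbarLinear (nonholTermDeriv N z)) =
      Complex.I / (4 * Real.sqrt Real.pi) *
        Complex.exp (Real.pi * Complex.I * (N : ℂ) ^ 2 * (2 * z)) := by
  have hD : dbarLinear (nonholTermDeriv N z) = Complex.I / 2 *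
      (((-(4 * Real.pi * N ^ 3) * (Real.exp (-(4 * Real.pi * N ^ 2 * z.im)) *
        (4 * Real.pi * N ^ 2 * z.im) ^ (-(3:ℝ)/2)) : ℝ) : ℂ) *
      Complex.exp (-2 * Real.pi * Complex.I * (N : ℂ) ^ 2 * z)) := by
    rw [dbarLinear_apply]
    simp only [nonholTermDeriv, add_apply, smul_apply,
      ContinuousLinearMap.comp_apply, imCLM_apply, ofRealCLM_apply, one_im, I_im,
      ContinuousLinearMap.id_apply, smul_eq_mul, ofReal_zero, ofReal_one]
    linear_combination (1 / 2) * ((N : ℂ) *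
      (incGammaNegHalf (4 * Real.pi * N ^ 2 * z.im) : ℂ) *
      (Complex.exp (-2 * Real.pi * Complex.I * (N : ℂ) ^ 2 * z) *
      (-2 * Real.pi * Complex.I * (N : ℂ) ^ 2))) * I_mul_I
  have hexp : Complex.exp (((-(4 * Real.pi * N ^ 2 * z.im) : ℝ) : ℂ)) *
      Complex.exp ((starRingEnd ℂ) (-2 * Real.pi * Complex.I * (N : ℂ) ^ 2 * z)) =
      Complex.exp (Real.pi * Complex.I * (N : ℂ) ^ 2 * (2 * z)) := by
    rw [← Complex.exp_add]
    congr 1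
    have hconj : (starRingEnd ℂ) z = z - 2 * z.im * Complex.I := by
      apply Complex.ext <;> simp
      ring
    simp only [map_mul, map_neg, map_pow, conj_ofReal, conj_I, hconj, map_ofNat]
    push_cast
    linear_combination (-4 * Real.pi * (N:ℂ) ^ 2 * z.im) * I_mul_I
  have hreal : (((4 * Real.pi * N ^ 2 * z.im) ^ (-(3:ℝ)/2) : ℝ) : ℂ) * (4 * Real.pi * N ^ 3) *
      ((z.im ^ ((3:ℝ)/2) : ℝ) : ℂ) = 1 / (2 * Real.sqrt Real.pi) := by
    exact_mod_cast congrArg (fun x : ℝ => (x : ℂ)) (rpow_four_pi_sq_mul hN hz)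
  rw [hD, ← hexp, Complex.exp_conj, map_mul, map_mul, conj_ofReal, map_div₀, conj_I, map_ofNat]
  push_cast
  linear_combination (Complex.I / 2 * Complex.exp (-(4 * Real.pi * (N : ℂ) ^ 2 * z.im)) *
    (starRingEnd ℂ) (Complex.exp (-2 * Real.pi * Complex.I * (N : ℂ) ^ 2 * z))) * hreal

lemma hasFDerivAt_inv_sqrt_im {z : ℂ} (hz : 0 < z.im) :
    HasFDerivAt (fun w : ℂ => (1 : ℂ) / (8 * Real.pi * Real.sqrt w.im))
      (((-(1 / (16 * Real.pi)) * z.im ^ (-(3:ℝ)/2) : ℝ) : ℂ) • (ofRealCLM.comp imCLM)) z := by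
  have hr : HasDerivAt (fun v : ℝ => 1 / (8 * Real.pi) * v ^ (-(1:ℝ)/2))
      (-(1 / (16 * Real.pi)) * z.im ^ (-(3:ℝ)/2)) z.im := by
    convert! (Real.hasDerivAt_rpow_const (p := -(1:ℝ)/2) (Or.inl hz.ne')).const_mul
      (1 / (8 * Real.pi)) using 1
    rw [show -(1:ℝ)/2 - 1 = -3/2 by norm_num]
    ring
  have hcomp := ofRealCLM.hasFDerivAt.comp z (hr.hasFDerivAt.comp z imCLM.hasFDerivAt)
  refine (hcomp.congr_fderiv ?_).congr_of_eventuallyEq ?_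
  · ext
    simp [mul_comm]
  · filter_upwards [(isOpen_lt continuous_const Complex.continuous_im).mem_nhds hz] with w hw
    have hw : 0 < w.im := hw
    simp only [Function.comp_apply, ofRealCLM_apply]
    rw [neg_div, Real.rpow_neg hw.le, ← Real.sqrt_eq_rpow]
    push_cast
    rw [one_div_mul_eq_div, one_div, mul_inv, div_eq_mul_inv, mul_comm]

lemma Theta_eq_jacobiTheta (τ : ℂ) : Theta τ = jacobiTheta (2 * τ) :=
  tsum_congr fun n => by congr 1; ring

lemma zagierHminus_eq (z : ℂ) : zagierHminus z =
    (1 / (4 * Real.sqrt Real.pi)) * (∑' n : ℕ, nonholTerm ((n : ℝ) + 1) z) +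
      1 / (8 * Real.pi * Real.sqrt z.im) := by
  simp only [zagierHminus, nonholTerm]
  push_cast
  rfl

/-- The shadow of Zagier's mock modular form: ξ_{3/2}(ℋ⁻) = −(1/(16π)) Θ. -/
theorem xi_zagierHminus (τ : ℂ) (hτ : 0 < τ.im) :
    xiThreeHalves zagierHminus τ = -(1 / (16 * Real.pi)) * Theta τ := by
  have hderiv := ((hasFDerivAt_tsum_nonholTerm hτ).const_mul
    ((1 : ℂ) / (4 * Real.sqrt Real.pi))).add (hasFDerivAt_inv_sqrt_im hτ)
  replace hderiv := hderiv.congr_of_eventuallyEq (.of_forall zagierHminus_eq)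
  have hdbar : dbar zagierHminus τ = 1 / (4 * Real.sqrt Real.pi) *
      dbarLinear (∑' n : ℕ, nonholTermDeriv ((n : ℝ) + 1) τ) +
      Complex.I / 2 * ((-(1 / (16 * Real.pi)) * τ.im ^ (-(3:ℝ)/2) : ℝ) : ℂ) := by
    rw [dbar, hderiv.fderiv, dbarLinear_apply]
    simp
    ring
  have hsum : ((τ.im ^ ((3:ℝ)/2) : ℝ) : ℂ) *
      (starRingEnd ℂ) (dbarLinear (∑' n : ℕ, nonholTermDeriv ((n : ℝ) + 1) τ)) =
      Complex.I / (4 * Real.sqrt Real.pi) * ((jacobiTheta (2 * τ) - 1) / 2) := by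
    have hleft := ((((summable_nonholTermDeriv hτ).hasSum.mapL dbarLinear).mapL
      (conjCLE : ℂ →L[ℝ] ℂ))).mul_left ((τ.im ^ ((3:ℝ)/2) : ℝ) : ℂ)
    have hright := (hasSum_nat_jacobiTheta (τ := 2 * τ) (by simpa using hτ)).mul_left
      (Complex.I / (4 * Real.sqrt Real.pi))
    refine hleft.unique (hright.congr_fun fun n => ?_)
    simpa using (rpow_mul_conj_dbarLinear_nonholTermDeriv (N := n + 1) (by positivity) hτ)
  have hpow : ((τ.im ^ ((3:ℝ)/2) : ℝ) : ℂ) * ((τ.im ^ (-(3:ℝ)/2) : ℝ) : ℂ) = 1 := by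
    rw [← ofReal_mul, ← Real.rpow_add hτ]
    norm_num
  have hpi : (1 / (Real.sqrt Real.pi : ℂ)) * (1 / Real.sqrt Real.pi) = 1 / Real.pi := by
    rw [one_div_mul_one_div]
    exact_mod_cast congrArg (fun x : ℝ => 1 / (x : ℂ)) (Real.mul_self_sqrt Real.pi_pos.le)
  rw [xiThreeHalves, hdbar, Theta_eq_jacobiTheta, ofReal_mul (-(1 / (16 * Real.pi)))]
  simp only [map_add, map_mul, map_div₀, map_one, map_ofNat, conj_I, conj_ofReal]
  push_cast
  linear_combination (2 * Complex.I / (4 * Real.sqrt Real.pi)) * hsum +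
    (Complex.I * Complex.I / (16 * Real.pi)) * hpow +
    (Complex.I * Complex.I * (jacobiTheta (2 * τ) - 1) / 16) * hpi +
    (jacobiTheta (2 * τ) / (16 * Real.pi)) * I_mul_I

end
end

section
/- Let n be a nonzero integer with n ≡ 2 or 3 (mod 4). Then E_n(s) = 0 for every s ∈ ℂ with Re(s) > 3/2. -/
open Complex

noncomputable section

/-- λ(a,c): i^{(1−c)/2}(a/c) if c odd, a even; i^{a/2}(c/a) if a odd, c even; 0 otherwise,
where i^x := e^{iπx/2}. -/
def lamb (a c : ℕ) : ℂ :=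
  if Odd c ∧ Even a then
    Complex.exp (Real.pi * Complex.I * ((1 - (c : ℂ)) / 2) / 2) * (jacobiSym a c : ℂ)
  else if Odd a ∧ Even c then
    Complex.exp (Real.pi * Complex.I * ((a : ℂ) / 2) / 2) * (jacobiSym c a : ℂ)
  else 0

/-- The Gauss sum γ_c(n) = c^{−1/2} Σ_{a=1}^{2c} λ(a,c) e^{−πina/c}. -/
def gaussG (c : ℕ) (n : ℤ) : ℂ :=
  (c : ℂ) ^ (-(1 : ℂ) / 2) *
    ∑ a ∈ Finset.Icc 1 (2 * c), lamb a c * Complex.exp (-Real.pi * Complex.I * n * a / c)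

/-- The Dirichlet series E_n(s) = (1/2) Σ_{c ≥ 1 odd} γ_c(n) c^{−s}
+ (1/2) Σ_{c ≥ 2 even} γ_c(n) (c/2)^{−s}. -/
def En (n : ℤ) (s : ℂ) : ℂ :=
  (1/2) * (∑' c : ℕ, if Odd c then gaussG c n * (c : ℂ) ^ (-s) else 0)
  + (1/2) * (∑' c : ℕ, if Even c ∧ c ≠ 0 then gaussG c n * ((c : ℂ) / 2) ^ (-s) else 0)

/-- If `F` changes sign under translation by `d`, its sum over `2 * d * k` consecutive integers is
zero. -/
theorem sum_Icc_eq_zero_of_antiperiodic {F : ℕ → ℂ} {d : ℕ} (hF : ∀ a, F (a + d) = -F a) (k : ℕ) :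
    ∑ a ∈ Finset.Icc 1 (2 * d * k), F a = 0 := by
  rw [← Finset.Ico_add_one_right_eq_Icc, Finset.sum_Ico_eq_sum_range, Nat.add_sub_cancel]
  induction k with
  | zero => simp
  | succ k ih =>
    rw [show 2 * d * (k + 1) = 2 * d * k + d + d by ring, Finset.sum_range_add,
      Finset.sum_range_add, ih, zero_add, ← Finset.sum_add_distrib]
    refine Finset.sum_eq_zero fun x _ => ?_
    rw [show 1 + (2 * d * k + d + x) = 1 + (2 * d * k + x) + d by ring, hF, add_neg_cancel]

theorem sum_range_add_of_periodic {g : ℕ → ℂ} {m : ℕ} (hg : ∀ w, g (w + m) = g w) (j : ℕ) :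
    ∑ w ∈ Finset.range m, g (w + j) = ∑ w ∈ Finset.range m, g w := by
  induction j with
  | zero => rfl
  | succ j ih =>
    have h1 := Finset.sum_range_succ (fun w => g (w + j)) m
    have h2 := Finset.sum_range_succ' (fun w => g (w + j)) m
    rw [h1, show m + j = j + m by ring, hg, zero_add] at h2
    rw [← ih, add_right_cancel h2]
    exact Finset.sum_congr rfl fun w _ => by congr 1; ring

theorem sum_Icc_two_mul (F : ℕ → ℂ) (m : ℕ) :
    ∑ a ∈ Finset.Icc 1 (2 * m), F a =
      ∑ w ∈ Finset.range m, (F (2 * w + 1) + F (2 * w + 2)) := by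
  induction m with
  | zero => simp
  | succ m ih =>
    rw [Finset.sum_range_succ, ← ih, show 2 * (m + 1) = 2 * m + 1 + 1 by ring,
      Finset.sum_Icc_succ_top (by lia), Finset.sum_Icc_succ_top (by lia)]
    ring

theorem sum_Icc_four_mul (F : ℕ → ℂ) (m : ℕ) :
    ∑ a ∈ Finset.Icc 1 (4 * m), F a =
      ∑ w ∈ Finset.range m,
        (F (4 * w + 1) + F (4 * w + 2) + F (4 * w + 3) + F (4 * w + 4)) := by
  induction m with
  | zero => simp
  | succ m ih =>
    rw [Finset.sum_range_succ, ← ih, show 4 * (m + 1) = 4 * m + 1 + 1 + 1 + 1 by ring,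
      Finset.sum_Icc_succ_top (by lia), Finset.sum_Icc_succ_top (by lia),
      Finset.sum_Icc_succ_top (by lia), Finset.sum_Icc_succ_top (by lia)]
    ring

theorem exp_pi_mul_I_mul_int (M : ℤ) : exp (Real.pi * I * M) = (-1) ^ M := by
  rw [mul_comm, exp_int_mul, exp_pi_mul_I]

/-- The summand of the Gauss sum. -/
def gaussTerm (c : ℕ) (n : ℤ) (a : ℕ) : ℂ :=
  lamb a c * exp (-Real.pi * I * n * a / c)

theorem gaussTerm_of_even_even {c : ℕ} (hc : Even c) (n : ℤ) {a : ℕ} (ha : Even a) :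
    gaussTerm c n a = 0 := by
  simp [gaussTerm, lamb, hc, ha, Nat.not_odd_iff_even.mpr]

theorem gaussTerm_of_odd_odd {c : ℕ} (hc : Odd c) (n : ℤ) {a : ℕ} (ha : Odd a) :
    gaussTerm c n a = 0 := by
  simp [gaussTerm, lamb, hc, ha, Nat.not_even_iff_odd.mpr]

theorem gaussTerm_of_odd_left {c : ℕ} (hc : Even c) (n : ℤ) {a : ℕ} (ha : Odd a) :
    gaussTerm c n a = jacobiSym c a * exp (Real.pi * I * (a / 4 - n * a / c)) := by
  have h : ¬ (Odd c ∧ Even a) := by simp [hc]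
  rw [gaussTerm, lamb, if_neg h, if_pos ⟨ha, hc⟩, mul_assoc, mul_left_comm, ← exp_add]
  ring_nf

theorem gaussTerm_add {c d : ℕ} (hc : Even c) (hc0 : c ≠ 0) (hd : Even d) {n M : ℤ}
    (hM : (c : ℤ) * d - 4 * n * d = 4 * c * M) {ε : ℤ}
    (hJ : ∀ a, Odd a → jacobiSym c (a + d) = ε * jacobiSym c a) (a : ℕ) :
    gaussTerm c n (a + d) = ε * (-1) ^ M * gaussTerm c n a := by
  rcases Nat.even_or_odd a with ha | ha
  · rw [gaussTerm_of_even_even hc n ha, gaussTerm_of_even_even hc n (ha.add hd), mul_zero]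
  · have hM' : (c : ℂ) * d - 4 * n * d = 4 * c * M := by exact_mod_cast hM
    have hc' : (c : ℂ) ≠ 0 := by exact_mod_cast hc0
    rw [gaussTerm_of_odd_left hc n ha, gaussTerm_of_odd_left hc n (ha.add_even hd), hJ a ha,
      show (Real.pi * I * ((a + d : ℕ) / 4 - n * (a + d : ℕ) / c) : ℂ) =
        Real.pi * I * M + Real.pi * I * (a / 4 - n * a / c) by
          rw [← mul_add]
          congr 1
          field_simp
          push_cast
          linear_combination hM',
      exp_add, exp_pi_mul_I_mul_int]
    push_cast
    ring

theorem jacobiSym_right_add {m a d : ℕ} (ha : Odd a) (h : 4 * m ∣ d) :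
    jacobiSym m (a + d) = jacobiSym m a := by
  obtain ⟨t, rfl⟩ := h
  have hd : Even (4 * m * t) := ⟨2 * m * t, by ring⟩
  rw [jacobiSym.mod_right' m ha, jacobiSym.mod_right' m (ha.add_even hd), Nat.add_mul_mod_self_left]

theorem jacobiSym_two_right_add_four {a t : ℕ} (ha : Odd a) (ht : Odd t) :
    jacobiSym 2 (a + 4 * t) = -jacobiSym 2 a := by
  have h4 : Even (4 * t) := ⟨2 * t, by ring⟩
  rw [jacobiSym.at_two ha, jacobiSym.at_two (ha.add_even h4), ZMod.χ₈_nat_eq_if_mod_eight,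
    ZMod.χ₈_nat_eq_if_mod_eight]
  grind

theorem jacobiSym_right_add_two_mul {m a : ℕ} (hm : Odd m) (ha : Odd a) :
    jacobiSym m (a + 2 * m) = (-1) ^ (m / 2) * jacobiSym m a := by
  have hb : Odd (a + 2 * m) := ha.add_even ⟨m, by ring⟩
  rw [jacobiSym.quadratic_reciprocity hm hb, jacobiSym.quadratic_reciprocity hm ha]
  have h1 : jacobiSym ((a + 2 * m : ℕ) : ℤ) m = jacobiSym (a : ℤ) m :=
    jacobiSym.mod_left' (by push_cast; exact Int.add_mul_emod_self_right _ _ _)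
  rw [h1, ← mul_assoc, ← pow_add]
  congr 1
  rw [show (a + 2 * m) / 2 = a / 2 + m by lia]
  obtain ⟨t, rfl⟩ := hm
  rw [show (2 * t + 1) / 2 = t by lia, show t * (a / 2 + (2 * t + 1)) =
    t + t * (a / 2) + 2 * (t * t) by ring, pow_add _ _ (2 * (t * t)), pow_mul]
  simp

theorem jacobiSym_four_mul_left (j : ℤ) {a : ℕ} (ha : Odd a) :
    jacobiSym (4 * j) a = jacobiSym j a := by
  rw [jacobiSym.mul_left, jacobiSym.at_four ha, one_mul]

theorem exists_gaussTerm_antiperiodic {c : ℕ} (h4c : 4 ∣ c) (hc : c ≠ 0) {n : ℤ}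
    (hn : n % 4 = 2 ∨ n % 4 = 3) :
    ∃ d k : ℕ, 2 * c = 2 * d * k ∧ ∀ a, gaussTerm c n (a + d) = -gaussTerm c n a := by
  have key : ∀ (d : ℕ) (M ε : ℤ), Even d → (c : ℤ) * d - 4 * n * d = 4 * c * M →
      (∀ a, Odd a → jacobiSym c (a + d) = ε * jacobiSym c a) → ε * (-1) ^ M.natAbs = -1 →
      ∀ a, gaussTerm c n (a + d) = -gaussTerm c n a := by
    intro d M ε hd hM hJ hε a
    have hceven : Even c := (by decide : Even 4).trans_dvd h4c
    have h1 : ((-1 : ℂ)) ^ M = ((-1 : ℤ) ^ M.natAbs : ℤ) := by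
      push_cast
      rcases Int.even_or_odd M with h | h
      · rw [h.neg_one_zpow, (Int.natAbs_even.mpr h).neg_one_pow]
      · rw [h.neg_one_zpow, (Int.natAbs_odd.mpr h).neg_one_pow]
    rw [gaussTerm_add hceven hc hd hM hJ, h1, ← Int.cast_mul, hε]
    simp
  obtain ⟨j, rfl⟩ := h4c
  have hj0 : j ≠ 0 := by rintro rfl; simp at hc
  rcases hn with hn | hn
  · rcases Nat.even_or_odd' j with ⟨i, rfl | rfl⟩
    · rcases Nat.even_or_odd' i with ⟨l, rfl | rfl⟩
      · refine ⟨8 * l, 2, by ring, key _ (2 * l - n / 2) 1 ⟨4 * l, by ring⟩ ?_ ?_ ?_⟩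
        · obtain ⟨q, hq⟩ : ∃ q, n = 2 * q := ⟨n / 2, by lia⟩
          rw [show n / 2 = q by lia, hq]
          push_cast
          ring
        · intro a ha
          have ha' : Odd (a + 8 * l) := ha.add_even ⟨4 * l, by ring⟩
          push_cast
          rw [show (4 * (2 * (2 * l)) : ℤ) = 4 * (4 * l) by ring, jacobiSym_four_mul_left _ ha,
            jacobiSym_four_mul_left _ ha, jacobiSym_four_mul_left _ ha',
            jacobiSym_four_mul_left _ ha', jacobiSym_right_add ha ⟨2, by ring⟩, one_mul]
        · rw [(Int.natAbs_odd.mpr (by grind)).neg_one_pow]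
          norm_num
      · set l' := 2 * l + 1 with hl'
        have hl : Odd l' := ⟨l, hl'⟩
        refine ⟨4 * l', 2, by ring, key _ (l' - n / 2) (-1) ⟨2 * l', by ring⟩ ?_ ?_ ?_⟩
        · obtain ⟨q, hq⟩ : ∃ q, n = 2 * q := ⟨n / 2, by lia⟩
          rw [show n / 2 = q by lia, hq]
          push_cast
          ring
        · intro a ha
          have ha' : Odd (a + 4 * l') := ha.add_even ⟨2 * l', by ring⟩
          push_cast
          rw [jacobiSym_four_mul_left _ ha, jacobiSym_four_mul_left _ ha', jacobiSym.mul_left,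
            jacobiSym.mul_left, jacobiSym_right_add ha ⟨1, by ring⟩,
            jacobiSym_two_right_add_four ha hl]
          ring
        · rw [(Int.natAbs_even.mpr (by grind)).neg_one_pow]
          norm_num
    · set l' := 2 * i + 1 with hl'
      refine ⟨4 * l', 1, by ring, key _ (l' - n) 1 ⟨2 * l', by ring⟩ ?_ ?_ ?_⟩
      · push_cast
        ring
      · intro a ha
        have ha' : Odd (a + 4 * l') := ha.add_even ⟨2 * l', by ring⟩
        push_cast
        rw [jacobiSym_four_mul_left _ ha, jacobiSym_four_mul_left _ ha',
          jacobiSym_right_add ha ⟨1, by ring⟩, one_mul]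
      · rw [(Int.natAbs_odd.mpr (by grind)).neg_one_pow]
        norm_num
  · rcases Nat.even_or_odd' j with ⟨i, rfl | rfl⟩
    · refine ⟨8 * i, 1, by ring, key _ (2 * i - n) 1 ⟨4 * i, by ring⟩ ?_ ?_ ?_⟩
      · push_cast
        ring
      · intro a ha
        have ha' : Odd (a + 8 * i) := ha.add_even ⟨4 * i, by ring⟩
        have h := jacobiSym_right_add (m := 2 * i) (d := 8 * i) ha ⟨1, by ring⟩
        push_cast at h ⊢
        rw [jacobiSym_four_mul_left _ ha, jacobiSym_four_mul_left _ ha', h, one_mul]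
      · rw [(Int.natAbs_odd.mpr (by grind)).neg_one_pow]
        norm_num
    · set l' := 2 * i + 1 with hl'
      have hl : Odd l' := ⟨i, hl'⟩
      refine ⟨2 * l', 2, by ring, key _ ((l' - n) / 2) ((-1) ^ (l' / 2)) ⟨l', by ring⟩ ?_ ?_ ?_⟩
      · obtain ⟨q, hq⟩ : ∃ q, n = l' - 2 * q := ⟨(l' - n) / 2, by lia⟩
        rw [show (l' - n) / 2 = q by lia, hq]
        push_cast
        ring
      · intro a ha
        have ha' : Odd (a + 2 * l') := ha.add_even ⟨l', by ring⟩
        push_cast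
        rw [jacobiSym_four_mul_left _ ha, jacobiSym_four_mul_left _ ha',
          jacobiSym_right_add_two_mul hl ha]
      · rw [← pow_add]
        exact Odd.neg_one_pow (by grind)

theorem gaussG_eq_sum (c : ℕ) (n : ℤ) :
    gaussG c n = (c : ℂ) ^ (-(1 : ℂ) / 2) * ∑ a ∈ Finset.Icc 1 (2 * c), gaussTerm c n a :=
  rfl

theorem gaussG_eq_zero_of_four_dvd {c : ℕ} (h4c : 4 ∣ c) (hc : c ≠ 0) {n : ℤ}
    (hn : n % 4 = 2 ∨ n % 4 = 3) : gaussG c n = 0 := by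
  obtain ⟨d, k, hdk, h⟩ := exists_gaussTerm_antiperiodic h4c hc hn
  rw [gaussG_eq_sum, hdk, sum_Icc_eq_zero_of_antiperiodic h, mul_zero]

/-- The `k`-th power of the primitive eighth root of unity `e^{πi/4}`. -/
def eighthRoot (k : ℤ) : ℂ := exp (Real.pi * I * (k / 4))

theorem eighthRoot_eq_of_sub {k l M : ℤ} (h : k - l = 4 * M) :
    eighthRoot k = (-1) ^ M * eighthRoot l := by
  rw [eighthRoot, eighthRoot, ← exp_pi_mul_I_mul_int, ← exp_add, ← mul_add]
  have h' : (k : ℂ) - l = 4 * M := by exact_mod_cast h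
  congr 2
  linear_combination h' / 4

theorem eighthRoot_eq {k l : ℤ} (h : (k - l) % 8 = 0) : eighthRoot k = eighthRoot l := by
  rw [eighthRoot_eq_of_sub (k := k) (l := l) (M := (k - l) / 4) (by lia), Even.neg_one_zpow (by grind),
    one_mul]

theorem eighthRoot_eq_neg {k l : ℤ} (h : (k - l) % 8 = 4) : eighthRoot k = -eighthRoot l := by
  rw [eighthRoot_eq_of_sub (k := k) (l := l) (M := (k - l) / 4) (by lia), Odd.neg_one_zpow (by grind),
    neg_one_mul]

theorem eighthRoot_add (k l : ℤ) : eighthRoot (k + l) = eighthRoot k * eighthRoot l := by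
  rw [eighthRoot, eighthRoot, eighthRoot, ← exp_add]
  push_cast
  ring_nf

theorem eighthRoot_one_add_neg_one : eighthRoot 1 + eighthRoot (-1) = (√2 : ℝ) := by
  have h := two_cos ((Real.pi / 4 : ℝ) : ℂ)
  rw [← ofReal_cos, Real.cos_pi_div_four] at h
  rw [eighthRoot, eighthRoot, show Real.pi * I * ((1 : ℤ) / 4) = ((Real.pi / 4 : ℝ) : ℂ) * I by
      push_cast; ring,
    show Real.pi * I * ((-1 : ℤ) / 4) = -((Real.pi / 4 : ℝ) : ℂ) * I by push_cast; ring, ← h]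
  push_cast
  ring

theorem two_cpow_neg_half_mul_sqrt_two : (2 : ℂ) ^ (-(1 : ℂ) / 2) * (√2 : ℝ) = 1 := by
  have h : (2 : ℂ) ^ (-(1 : ℂ) / 2) = ((2 : ℝ) ^ (-(1 : ℝ) / 2) : ℝ) := by
    rw [ofReal_cpow (by norm_num)]
    push_cast
    rfl
  rw [h, ← ofReal_mul, Real.sqrt_eq_rpow, ← Real.rpow_add (by norm_num)]
  norm_num

/-- The summand of the Gauss sum of the Jacobi symbol modulo `m`. -/
def jacobiTerm (m : ℕ) (n : ℤ) (w : ℕ) : ℂ :=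
  jacobiSym w m * exp (-2 * Real.pi * I * n * w / m)

theorem jacobiTerm_periodic {m : ℕ} (hm : m ≠ 0) (n : ℤ) (w : ℕ) :
    jacobiTerm m n (w + m) = jacobiTerm m n w := by
  have hm' : (m : ℂ) ≠ 0 := by exact_mod_cast hm
  rw [jacobiTerm, jacobiTerm]
  congr 1
  · rw [jacobiSym.mod_left' (b := m) (a₂ := (w : ℤ)) (by simp)]
  · rw [show -2 * Real.pi * I * n * (w + m : ℕ) / m =
        -2 * Real.pi * I * n * w / m + (-n : ℤ) * (2 * Real.pi * I) by push_cast; field_simp; ring,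
      exp_add, exp_int_mul_two_pi_mul_I, mul_one]

theorem gaussTerm_two_mul {m : ℕ} (hm : Odd m) (n : ℤ) (w : ℕ) :
    gaussTerm m n (2 * w) = eighthRoot (1 - m) * jacobiSym 2 m * jacobiTerm m n w := by
  rw [gaussTerm, lamb, if_pos ⟨hm, even_two_mul w⟩, jacobiTerm, eighthRoot]
  push_cast
  rw [jacobiSym.mul_left]
  push_cast
  ring_nf

theorem sum_gaussTerm_of_odd {m : ℕ} (hm : Odd m) (n : ℤ) :
    ∑ a ∈ Finset.Icc 1 (2 * m), gaussTerm m n a =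
      eighthRoot (1 - m) * jacobiSym 2 m * ∑ w ∈ Finset.range m, jacobiTerm m n w := by
  rw [sum_Icc_two_mul, ← sum_range_add_of_periodic (jacobiTerm_periodic hm.pos.ne' n) 1,
    Finset.mul_sum]
  refine Finset.sum_congr rfl fun w _ => ?_
  rw [gaussTerm_of_odd_odd hm n ⟨w, rfl⟩, zero_add, ← gaussTerm_two_mul hm]
  ring_nf

theorem gaussTerm_two_mul_periodic {m : ℕ} (hm : Odd m) (n : ℤ) (a : ℕ) :
    gaussTerm (2 * m) n (a + 4 * m) = gaussTerm (2 * m) n a := by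
  rw [gaussTerm_add (ε := -1) (M := m - 2 * n) (even_two_mul m) (by have := hm.pos; lia)
    ⟨2 * m, by ring⟩ (by push_cast; ring) _ a, Odd.neg_one_zpow (by grind)]
  · simp
  · intro a ha
    push_cast
    rw [jacobiSym.mul_left, jacobiSym.mul_left, jacobiSym_two_right_add_four ha hm,
      jacobiSym_right_add ha dvd_rfl]
    ring

theorem jacobiSym_two_right_four_mul_add (w : ℕ) {x : ℕ} (hx : Odd x) :
    jacobiSym 2 (4 * w + x) = (-1) ^ w * jacobiSym 2 x := by
  induction w with
  | zero => simp
  | succ w ih =>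
    have h : Odd (4 * w + x) := Even.add_odd ⟨2 * w, by ring⟩ hx
    rw [show 4 * (w + 1) + x = 4 * w + x + 4 * 1 by ring, jacobiSym_two_right_add_four h odd_one,
      ih]
    ring

theorem gaussTerm_four_mul_add {m u : ℕ} (hm : Odd m) (hu : Odd u) (n : ℤ) (w : ℕ) :
    gaussTerm (2 * m) n (4 * w + m * u) =
      eighthRoot (m * u - 2 * n * u) * (jacobiSym 2 (m * u) * (-1) ^ (m / 2 * (m * u / 2)) : ℤ) *
        jacobiTerm m n w := by
  have hx : Odd (m * u) := hm.mul hu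
  have hb : Odd (4 * w + m * u) := Even.add_odd ⟨2 * w, by ring⟩ hx
  have hm' : (m : ℂ) ≠ 0 := by exact_mod_cast hm.pos.ne'
  have h1 : jacobiSym ((4 * w + m * u : ℕ) : ℤ) m = jacobiSym w m := by
    rw [jacobiSym.mod_left' (a₂ := 4 * w) (by push_cast; simp), jacobiSym_four_mul_left _ hm]
  have h2 : ((-1 : ℤ)) ^ (m / 2 * ((4 * w + m * u) / 2)) = (-1) ^ (m / 2 * (m * u / 2)) := by
    rw [show (4 * w + m * u) / 2 = 2 * w + m * u / 2 by lia, mul_add, pow_add, mul_left_comm,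
      pow_mul, neg_one_sq, one_pow, one_mul]
  have h3 : exp (Real.pi * I * ((4 * w + m * u : ℕ) / 4 - n * (4 * w + m * u : ℕ) / (2 * m : ℕ))) =
      (-1) ^ w * eighthRoot (m * u - 2 * n * u) * exp (-2 * Real.pi * I * n * w / m) := by
    rw [← zpow_natCast, ← exp_pi_mul_I_mul_int, eighthRoot, ← exp_add, ← exp_add]
    congr 1
    push_cast
    field_simp
    ring
  have h4 : ((-1 : ℂ)) ^ w * (-1) ^ w = 1 := by rw [← mul_pow]; norm_num
  rw [gaussTerm_of_odd_left (even_two_mul m) n hb, h3, Nat.cast_mul, jacobiSym.mul_left,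
    jacobiSym.quadratic_reciprocity hm hb, h1, h2, Nat.cast_two,
    jacobiSym_two_right_four_mul_add w hx, jacobiTerm]
  push_cast
  linear_combination (jacobiSym 2 (m * u) * (-1) ^ (m / 2 * (m * u / 2)) * jacobiSym w m *
    eighthRoot (m * u - 2 * n * u) * exp (-2 * Real.pi * I * n * w / m) : ℂ) * h4

theorem sum_gaussTerm_residue {m r u : ℕ} (hm : Odd m) (hu : Odd u) (hr : r ≤ m * u)
    (h4 : r % 4 = m * u % 4) (n : ℤ) :
    ∑ w ∈ Finset.range m, gaussTerm (2 * m) n (4 * w + r) =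
      eighthRoot (m * u - 2 * n * u) * (jacobiSym 2 (m * u) * (-1) ^ (m / 2 * (m * u / 2)) : ℤ) *
        ∑ w ∈ Finset.range m, jacobiTerm m n w := by
  have hper : ∀ w, gaussTerm (2 * m) n (4 * (w + m) + r) = gaussTerm (2 * m) n (4 * w + r) := by
    intro w
    rw [← gaussTerm_two_mul_periodic hm n (4 * w + r)]
    ring_nf
  rw [← sum_range_add_of_periodic (g := fun w => gaussTerm (2 * m) n (4 * w + r)) hper
    ((m * u - r) / 4), Finset.mul_sum]
  refine Finset.sum_congr rfl fun w _ => ?_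
  rw [← gaussTerm_four_mul_add hm hu]
  congr 1
  lia

theorem sum_gaussTerm_two_mul {m : ℕ} (hm : Odd m) (n : ℤ) :
    ∑ a ∈ Finset.Icc 1 (2 * (2 * m)), gaussTerm (2 * m) n a =
      (eighthRoot (m - 2 * n) * (-1) ^ (m / 2) - eighthRoot (3 * m - 6 * n)) * jacobiSym 2 m *
        ∑ w ∈ Finset.range m, jacobiTerm m n w := by
  have hsplit : ∑ a ∈ Finset.Icc 1 (2 * (2 * m)), gaussTerm (2 * m) n a =
      ∑ w ∈ Finset.range m, gaussTerm (2 * m) n (4 * w + 1) +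
        ∑ w ∈ Finset.range m, gaussTerm (2 * m) n (4 * w + 3) := by
    rw [show 2 * (2 * m) = 4 * m by ring, sum_Icc_four_mul, ← Finset.sum_add_distrib]
    refine Finset.sum_congr rfl fun w _ => ?_
    rw [gaussTerm_of_even_even (even_two_mul m) n (a := 4 * w + 2) ⟨2 * w + 1, by ring⟩,
      gaussTerm_of_even_even (even_two_mul m) n (a := 4 * w + 4) ⟨2 * w + 2, by ring⟩]
    ring
  have hresidue : ∑ a ∈ Finset.Icc 1 (2 * (2 * m)), gaussTerm (2 * m) n a =
      eighthRoot (m * (1 : ℕ) - 2 * n * (1 : ℕ)) *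
          (jacobiSym 2 (m * 1) * (-1) ^ (m / 2 * (m * 1 / 2)) : ℤ) *
          ∑ w ∈ Finset.range m, jacobiTerm m n w +
        eighthRoot (m * (3 : ℕ) - 2 * n * (3 : ℕ)) *
          (jacobiSym 2 (m * 3) * (-1) ^ (m / 2 * (m * 3 / 2)) : ℤ) *
          ∑ w ∈ Finset.range m, jacobiTerm m n w := by
    rw [hsplit]
    rcases Nat.odd_mod_four_iff.mp (Nat.odd_iff.mp hm) with h | h
    · rw [sum_gaussTerm_residue hm odd_one (by lia) (by lia),
        sum_gaussTerm_residue hm (by decide : Odd 3) (by lia) (by lia)]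
    · rw [add_comm, sum_gaussTerm_residue hm odd_one (r := 3) (by lia) (by lia),
        sum_gaussTerm_residue hm (by decide : Odd 3) (r := 1) (by lia) (by lia)]
  have hthree : jacobiSym 2 (m * 3) = -jacobiSym 2 m := by
    have : NeZero m := ⟨hm.pos.ne'⟩
    rw [jacobiSym.mul_right, show jacobiSym 2 3 = -1 by
      rw [jacobiSym.at_two (by decide)]; decide]
    ring
  have hsign₁ : ((-1 : ℂ)) ^ (m / 2 * (m / 2)) = (-1) ^ (m / 2) := by
    rcases Nat.even_or_odd (m / 2) with h | h
    · rw [h.neg_one_pow, (h.mul_left _).neg_one_pow]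
    · rw [h.neg_one_pow, (h.mul h).neg_one_pow]
  have hsign₃ : ((-1 : ℂ)) ^ (m / 2 * (m * 3 / 2)) = 1 := by
    refine Even.neg_one_pow ?_
    rcases Nat.even_or_odd (m / 2) with h | h
    · exact h.mul_right _
    · exact Even.mul_left (by grind) _
  rw [hresidue, hthree]
  push_cast
  simp only [mul_one]
  rw [hsign₁, hsign₃]
  ring_nf

theorem eighthRoot_identity {m : ℕ} (hm : Odd m) {n : ℤ} (hn : n % 4 = 2 ∨ n % 4 = 3) :
    eighthRoot (m - 2 * n) * (-1) ^ (m / 2) - eighthRoot (3 * m - 6 * n) =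
      -((√2 : ℝ) * eighthRoot (1 - m)) := by
  rw [← eighthRoot_one_add_neg_one, add_mul, ← eighthRoot_add, ← eighthRoot_add]
  rcases Nat.odd_mod_four_iff.mp (Nat.odd_iff.mp hm) with h | h
  · rw [Even.neg_one_pow (by grind)]
    rcases hn with hn | hn
    · rw [eighthRoot_eq_neg (k := m - 2 * n) (l := 1 + (1 - m)) (by lia),
        eighthRoot_eq (k := 3 * m - 6 * n) (l := -1 + (1 - m)) (by lia)]
      ring
    · rw [eighthRoot_eq_neg (k := m - 2 * n) (l := -1 + (1 - m)) (by lia),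
        eighthRoot_eq (k := 3 * m - 6 * n) (l := 1 + (1 - m)) (by lia)]
      ring
  · rw [Odd.neg_one_pow (by grind)]
    rcases hn with hn | hn
    · rw [eighthRoot_eq (k := m - 2 * n) (l := 1 + (1 - m)) (by lia),
        eighthRoot_eq (k := 3 * m - 6 * n) (l := -1 + (1 - m)) (by lia)]
      ring
    · rw [eighthRoot_eq (k := m - 2 * n) (l := -1 + (1 - m)) (by lia),
        eighthRoot_eq (k := 3 * m - 6 * n) (l := 1 + (1 - m)) (by lia)]
      ring

theorem gaussG_two_mul_of_odd {m : ℕ} (hm : Odd m) {n : ℤ} (hn : n % 4 = 2 ∨ n % 4 = 3) :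
    gaussG (2 * m) n = -gaussG m n := by
  rw [gaussG_eq_sum, gaussG_eq_sum, sum_gaussTerm_of_odd hm, sum_gaussTerm_two_mul hm,
    eighthRoot_identity hm hn, Nat.cast_mul, natCast_mul_natCast_cpow, Nat.cast_two]
  linear_combination (-(m : ℂ) ^ (-(1 : ℂ) / 2) * eighthRoot (1 - m) * jacobiSym 2 m *
    ∑ w ∈ Finset.range m, jacobiTerm m n w) * two_cpow_neg_half_mul_sqrt_two

/-- Zagier: E_n(s) vanishes when n ≡ 2, 3 (mod 4). -/
theorem En_eq_zero (n : ℤ) (hn : n ≠ 0) (h4 : n % 4 = 2 ∨ n % 4 = 3)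
    (s : ℂ) (hs : 3/2 < s.re) : En n s = 0 := by
  have hinj : Function.Injective fun m : ℕ => 2 * m := fun a b h => by simpa using h
  have heven : (∑' c : ℕ, if Even c ∧ c ≠ 0 then gaussG c n * ((c : ℂ) / 2) ^ (-s) else 0) =
      -∑' c : ℕ, if Odd c then gaussG c n * (c : ℂ) ^ (-s) else 0 := by
    rw [← hinj.tsum_eq, ← tsum_neg]
    · refine tsum_congr fun m => ?_
      rcases Nat.even_or_odd m with hm | hm
      · rw [if_neg (Nat.not_odd_iff_even.mpr hm), neg_zero]
        refine ite_eq_right_iff.mpr fun h => ?_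
        rw [gaussG_eq_zero_of_four_dvd (by grind) h.2 h4, zero_mul]
      · rw [if_pos hm, if_pos ⟨even_two_mul m, by have := hm.pos; lia⟩,
          gaussG_two_mul_of_odd hm h4, neg_mul]
        push_cast
        rw [mul_div_cancel_left₀ _ (two_ne_zero)]
    · intro c hc
      have hc' : Even c := by
        by_contra h
        exact hc (if_neg fun h' => h h'.1)
      obtain ⟨m, rfl⟩ := hc'.two_dvd
      exact ⟨m, rfl⟩
  rw [En, heven]
  ring

end
end
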